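/- Let k ≥ 2 and x, y ∈ X_k. If ρ(y) = g·ρ(x) for some g ∈ S_k (acting by permuting the k pair-coordinates), then y = h·x for some h ∈ Z_k. Consequently, the assignment sending the Z_k-orbit of x to the S_k-orbit of ρ(x) is a well-defined and injective map from Z_k-orbits of points of X_k to S_k-orbits in (ℝ²)^k. -/

import Mathlib

/-- Action of a permutation `g` on tuples: `(g · x)_i = x_{g i}`. -/
def permAct {ι α : Type*} (g : Equiv.Perm ι) (x : ι → α) : ι → α := fun i => x (g i)

/-- `Z_k`: the cyclic subgroup of `S_k` generated by the cyclic shift `τ`. -/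
def Zsub (k : ℕ) : Subgroup (Equiv.Perm (Fin k)) := Subgroup.zpowers (finRotate k)

/-- `ρ(x)_i = (x_i, x_{τ(i)})`. -/
def rhoZ (k : ℕ) (x : Fin k → ℝ) : Fin k → ℝ × ℝ := fun i => (x i, x (finRotate k i))

/-- `X_k`: points of `[0,1]^k` with pairwise distinct coordinates. -/
def Xset (k : ℕ) : Set (Fin k → ℝ) :=
  {x | (∀ i, x i ∈ Set.Icc (0 : ℝ) 1) ∧ Function.Injective x}

/-- The orbit of `x` under a subgroup `G` of permutations. -/
def orbitOf {ι α : Type*} (G : Subgroup (Equiv.Perm ι)) (x : ι → α) : Set (ι → α) :=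
  {y | ∃ g ∈ G, y = permAct g x}

theorem self_mem_orbitOf {ι α : Type*} (G : Subgroup (Equiv.Perm ι)) (x : ι → α) :
    x ∈ orbitOf G x :=
  ⟨1, G.one_mem, rfl⟩

theorem orbitOf_permAct {ι α : Type*} {G : Subgroup (Equiv.Perm ι)} {g : Equiv.Perm ι}
    (hg : g ∈ G) (x : ι → α) : orbitOf G (permAct g x) = orbitOf G x := by
  ext z
  constructor
  · rintro ⟨a, ha, rfl⟩
    exact ⟨g * a, G.mul_mem hg ha, rfl⟩
  · rintro ⟨a, ha, rfl⟩
    refine ⟨g⁻¹ * a, G.mul_mem (G.inv_mem hg) ha, ?_⟩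
    funext i
    simp [permAct]

/-- A permutation commuting with a transitive permutation is a power of it. -/
theorem Equiv.Perm.mem_zpowers_of_commute {ι : Type*} {σ g : Equiv.Perm ι}
    (hσ : ∀ i j, σ.SameCycle i j) (hg : Commute g σ) : g ∈ Subgroup.zpowers σ := by
  rcases isEmpty_or_nonempty ι with hι | ⟨⟨a⟩⟩
  · exact Subsingleton.elim 1 g ▸ Subgroup.one_mem _
  obtain ⟨n, hn⟩ := hσ a (g a)
  refine ⟨n, Equiv.ext fun i => ?_⟩
  obtain ⟨m, rfl⟩ := hσ a i
  have hcomm : g ((σ ^ m) a) = (σ ^ m) (g a) :=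
    Equiv.congr_fun (hg.zpow_right m).eq a
  change (σ ^ n) ((σ ^ m) a) = g ((σ ^ m) a)
  rw [hcomm, ← hn]
  exact Equiv.congr_fun (Commute.zpow_zpow_self σ n m).eq a

theorem sameCycle_finRotate {k : ℕ} (hk : 2 ≤ k) (i j : Fin k) :
    (finRotate k).SameCycle i j := by
  have hmem (l : Fin k) : finRotate k l ≠ l := by
    rw [← Equiv.Perm.mem_support, support_finRotate_of_le hk]
    exact Finset.mem_univ l
  exact (isCycle_finRotate_of_le hk).sameCycle (hmem i) (hmem j)

theorem mem_Zsub_of_rhoZ_eq {k : ℕ} (hk : 2 ≤ k) {x y : Fin k → ℝ}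
    (hx : Function.Injective x) {g : Equiv.Perm (Fin k)}
    (h : rhoZ k y = permAct g (rhoZ k x)) : g ∈ Zsub k := by
  refine Equiv.Perm.mem_zpowers_of_commute (sameCycle_finRotate hk)
    (Equiv.ext fun i => hx ?_)
  have hfst : y (finRotate k i) = x (g (finRotate k i)) :=
    congrArg Prod.fst (congrFun h (finRotate k i))
  have hsnd : y (finRotate k i) = x (finRotate k (g i)) :=
    congrArg Prod.snd (congrFun h i)
  exact hfst.symm.trans hsnd

theorem eq_permAct_of_rhoZ_eq {k : ℕ} {x y : Fin k → ℝ} {g : Equiv.Perm (Fin k)}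
    (h : rhoZ k y = permAct g (rhoZ k x)) : y = permAct g x :=
  funext fun i => congrArg Prod.fst (congrFun h i)

theorem rhoZ_permAct {k : ℕ} {h : Equiv.Perm (Fin k)} (hh : h ∈ Zsub k) (x : Fin k → ℝ) :
    rhoZ k (permAct h x) = permAct h (rhoZ k x) := by
  obtain ⟨n, rfl⟩ := hh
  funext i
  have hcomm : (finRotate k ^ n) (finRotate k i) = finRotate k ((finRotate k ^ n) i) :=
    Equiv.congr_fun (Commute.zpow_self (finRotate k) n).eq i
  exact Prod.ext rfl (congrArg x hcomm)

/-- If `ρ(y) = g·ρ(x)` for some `g ∈ S_k` then `y = h·x` for some `h ∈ Z_k`;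
consequently `O_{Z_k}(x) ↦ O_{S_k}(ρ(x))` is a well-defined injective map on
orbits of points of `X_k`. -/
theorem stmt_5 (k : ℕ) (hk : 2 ≤ k) :
    (∀ x ∈ Xset k, ∀ y ∈ Xset k, ∀ g : Equiv.Perm (Fin k),
      rhoZ k y = permAct g (rhoZ k x) → ∃ h ∈ Zsub k, y = permAct h x) ∧
    (∀ x ∈ Xset k, ∀ y ∈ Xset k,
      (orbitOf (Zsub k) x = orbitOf (Zsub k) y →
        orbitOf (⊤ : Subgroup (Equiv.Perm (Fin k))) (rhoZ k x) =
          orbitOf (⊤ : Subgroup (Equiv.Perm (Fin k))) (rhoZ k y)) ∧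
      (orbitOf (⊤ : Subgroup (Equiv.Perm (Fin k))) (rhoZ k x) =
          orbitOf (⊤ : Subgroup (Equiv.Perm (Fin k))) (rhoZ k y) →
        orbitOf (Zsub k) x = orbitOf (Zsub k) y)) := by
  refine ⟨fun x hx y _ g h => ⟨g, mem_Zsub_of_rhoZ_eq hk hx.2 h, eq_permAct_of_rhoZ_eq h⟩,
    fun x hx y _ => ⟨fun h => ?_, fun h => ?_⟩⟩
  · obtain ⟨g, hg, rfl⟩ : y ∈ orbitOf (Zsub k) x := h ▸ self_mem_orbitOf _ y
    rw [rhoZ_permAct hg, orbitOf_permAct (Subgroup.mem_top g)]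
  · obtain ⟨g, -, hg⟩ : rhoZ k y ∈ orbitOf ⊤ (rhoZ k x) := h ▸ self_mem_orbitOf _ (rhoZ k y)
    rw [eq_permAct_of_rhoZ_eq hg, orbitOf_permAct (mem_Zsub_of_rhoZ_eq hk hx.2 hg)]
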